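/- Let 2 ≤ k̄ ≤ L/2, let Q = Σ_{A∈P_Λ, Diag A ≤ k̄} q_A A satisfy [H,Q] = 0, and let A be a Pauli product with Diag A = k̄. Then q_A = 0 unless A equals the standard-form product C^{k̄}_1 based at some site, or the standard-form product C^{k̄}_2 based at some site. -/

import Mathlib

open Complex Matrix

/-- Sites of the `L × L` square lattice with periodic boundary conditions. -/
abbrev Site (L : ℕ) := ZMod L × ZMod L

/-- A specification of a product of Pauli matrices: at each site either
`0` (no operator), `1` (`X`), `2` (`Y`) or `3` (`Z`). -/
abbrev PSpec (L : ℕ) := Site L → Fin 4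

/-- Operators on the Hilbert space `⊗_{u ∈ Λ} ℂ²`. -/
abbrev Op (L : ℕ) := Matrix (Site L → Fin 2) (Site L → Fin 2) ℂ

/-- The Pauli matrices (`0` gives the identity). -/
noncomputable def pauli (w : Fin 4) : Matrix (Fin 2) (Fin 2) ℂ :=
  if w = 1 then !![0, 1; 1, 0]
  else if w = 2 then !![0, -Complex.I; Complex.I, 0]
  else if w = 3 then !![1, 0; 0, -1]
  else 1

/-- The product of Pauli matrices specified by `σ`, as an operator (matrix)
on the full Hilbert space. -/
noncomputable def PauliOp (L : ℕ) [NeZero L] (σ : PSpec L) : Op L :=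
  fun s t => ∏ u : Site L, pauli (σ u) (s u) (t u)

/-- `DiagBoundAt L σ a k` : every site `u` in the support of `σ` satisfies
`0 ≤ uₓ + u_y − a ≤ k − 1 (mod L)`. -/
def DiagBoundAt (L : ℕ) (σ : PSpec L) (a : ZMod L) (k : ℕ) : Prop :=
  ∀ u : Site L, σ u ≠ 0 → (u.1 + u.2 - a).val < k

/-- The diagonal length of a Pauli product. -/
noncomputable def Diag (L : ℕ) (σ : PSpec L) : ℕ :=
  sInf {k | ∃ a : ZMod L, DiagBoundAt L σ a k}

/-- `X_u` as a Pauli-product specification. -/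
def sigX (L : ℕ) (u : Site L) : PSpec L := fun v => if v = u then 1 else 0
/-- `Y_u` as a Pauli-product specification. -/
def sigY (L : ℕ) (u : Site L) : PSpec L := fun v => if v = u then 2 else 0
/-- `Z_u` as a Pauli-product specification. -/
def sigZ (L : ℕ) (u : Site L) : PSpec L := fun v => if v = u then 3 else 0
/-- A single-site Pauli operator `W_u` (`w ∈ {1,2,3}`). -/
def sigW (L : ℕ) (u : Site L) (w : Fin 4) : PSpec L := fun v => if v = u then w else 0

/-- `X_u X_{u+eₓ}` as a Pauli-product specification. -/
def sigXX (L : ℕ) (u : Site L) : PSpec L :=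
  fun v => if v = u then 1 else if v = u + (1, 0) then 1 else 0
/-- `Y_u Y_{u+e_y}` as a Pauli-product specification. -/
def sigYY (L : ℕ) (u : Site L) : PSpec L :=
  fun v => if v = u then 2 else if v = u + (0, 1) then 2 else 0

/-- The quantum compass Hamiltonian
`H = −Σ_u (Jx X_u X_{u+eₓ} + Jy Y_u Y_{u+e_y})`. -/
noncomputable def Hcompass (L : ℕ) [NeZero L] (Jx Jy : ℝ) : Op L :=
  - ∑ u : Site L, ((Jx : ℂ) • PauliOp L (sigXX L u) + (Jy : ℂ) • PauliOp L (sigYY L u))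

/-- The quantum compass Hamiltonian with a uniform magnetic field. -/
noncomputable def Hfield (L : ℕ) [NeZero L] (Jx Jy hx hy hz : ℝ) : Op L :=
  - ∑ u : Site L,
      ((Jx : ℂ) • PauliOp L (sigXX L u) + (Jy : ℂ) • PauliOp L (sigYY L u)
        + (hx : ℂ) • PauliOp L (sigX L u) + (hy : ℂ) • PauliOp L (sigY L u)
        + (hz : ℂ) • PauliOp L (sigZ L u))

/-- The candidate conserved quantity `Q = Σ_σ q_σ σ`. -/
noncomputable def Qop (L : ℕ) [NeZero L] (q : PSpec L → ℂ) : Op L :=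
  ∑ σ : PSpec L, q σ • PauliOp L σ

/-- Commutator of operators. -/
noncomputable def opComm (L : ℕ) [NeZero L] (A B : Op L) : Op L := A * B - B * A

/-- The coefficient `λ_{σ,τ}` of the Pauli product `τ` in the expansion
`[H, σ] = Σ_τ λ_{σ,τ} τ`, extracted via the (normalized) trace inner product. -/
noncomputable def lam (L : ℕ) [NeZero L] (H : Op L) (σ τ : PSpec L) : ℂ :=
  Matrix.trace (PauliOp L τ * opComm L H (PauliOp L σ)) / (2 ^ Fintype.card (Site L))

/-- `u` is a top-right site of `σ` (relative to the witness `a` for diagonal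
length `k`). -/
def IsTopRight (L : ℕ) (σ : PSpec L) (a : ZMod L) (k : ℕ) (u : Site L) : Prop :=
  σ u ≠ 0 ∧ (u.1 + u.2 - a).val = k - 1

/-- `u` is a bottom-left site of `σ` (relative to the witness `a`). -/
def IsBottomLeft (L : ℕ) (σ : PSpec L) (a : ZMod L) (u : Site L) : Prop :=
  σ u ≠ 0 ∧ (u.1 + u.2 - a).val = 0

/-- Condition (1): `σ` has a unique top-right site `ū`, with
(1a) `σ_ū = X` and `ū − eₓ ∈ Supp σ`, or (1b) `σ_ū = Y` and `ū − e_y ∈ Supp σ`. -/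
def Cond1 (L : ℕ) (σ : PSpec L) (a : ZMod L) (k : ℕ) : Prop :=
  ∃ ub : Site L, (∀ v : Site L, IsTopRight L σ a k v ↔ v = ub) ∧
    ((σ ub = 1 ∧ σ (ub - (1, 0)) ≠ 0) ∨ (σ ub = 2 ∧ σ (ub - (0, 1)) ≠ 0))

/-- Condition (2): `σ` has a unique bottom-left site `u̲`, with
(2a) `σ_u̲ = X` and `u̲ + eₓ ∈ Supp σ`, or (2b) `σ_u̲ = Y` and `u̲ + e_y ∈ Supp σ`. -/
def Cond2 (L : ℕ) (σ : PSpec L) (a : ZMod L) : Prop :=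
  ∃ lb : Site L, (∀ v : Site L, IsBottomLeft L σ a v ↔ v = lb) ∧
    ((σ lb = 1 ∧ σ (lb + (1, 0)) ≠ 0) ∨ (σ lb = 2 ∧ σ (lb + (0, 1)) ≠ 0))

/-- `ShiftRel L k σ σ'` : `σ` has diagonal length `k`, satisfies conditions (1)
and (2), and `σ'` is the Shiraishi shift `S(σ)`, obtained by first appending a
site at the top right (the product `B`) and then truncating the bottom-left site. -/
def ShiftRel (L : ℕ) [NeZero L] (k : ℕ) (σ σ' : PSpec L) : Prop :=
  Diag L σ = k ∧ σ' ≠ 0 ∧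
  ∃ a : ZMod L, DiagBoundAt L σ a k ∧
  ∃ ub lb : Site L,
    (∀ v : Site L, IsTopRight L σ a k v ↔ v = ub) ∧
    (∀ v : Site L, IsBottomLeft L σ a v ↔ v = lb) ∧
    ∃ B : Op L,
      ((σ ub = 1 ∧ σ (ub - (1, 0)) ≠ 0 ∧
          B = (-(1 / (2 * Complex.I))) • opComm L (PauliOp L (sigYY L ub)) (PauliOp L σ)) ∨
       (σ ub = 2 ∧ σ (ub - (0, 1)) ≠ 0 ∧
          B = (1 / (2 * Complex.I)) • opComm L (PauliOp L (sigXX L ub)) (PauliOp L σ))) ∧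
      ∃ ε : ℂ, (ε = 1 / (2 * Complex.I) ∨ ε = -(1 / (2 * Complex.I))) ∧
        ((σ lb = 1 ∧ σ (lb + (1, 0)) ≠ 0 ∧
            PauliOp L σ' = ε • opComm L (PauliOp L (sigXX L lb)) B) ∨
         (σ lb = 2 ∧ σ (lb + (0, 1)) ≠ 0 ∧
            PauliOp L σ' = ε • opComm L (PauliOp L (sigYY L lb)) B))

/-- The staircase sequence `u_j`: `u_j = u₁ + ((j−1)/2)(eₓ+e_y)` for odd `j`,
and `u_j = u₁ + (j/2)(eₓ+e_y) − e_y` for even `j`. -/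
def stair (L : ℕ) (u1 : Site L) (j : ℕ) : Site L :=
  if j % 2 = 1 then
    u1 + ((((j - 1) / 2 : ℕ) : ZMod L), (((j - 1) / 2 : ℕ) : ZMod L))
  else
    u1 + (((j / 2 : ℕ) : ZMod L), ((j / 2 : ℕ) : ZMod L)) - ((0 : ZMod L), (1 : ZMod L))

/-- The Pauli letter at the first (bottom-left) end of `C^k_j`. -/
def endL (j : ℕ) : Fin 4 := if j % 2 = 1 then 1 else 2

/-- The Pauli letter at the last (top-right) end of `C^k_j`. -/
def endR (k j : ℕ) : Fin 4 :=
  if k % 2 = 1 then (if j % 2 = 1 then 2 else 1)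
  else (if j % 2 = 1 then 1 else 2)

/-- The standard-form product `C^k_j` based at `u₁`: the appropriate end
letters at `u_j` and `u_{j+k−1}`, and `Z` at `u_{j+1}, …, u_{j+k−2}`. -/
def Cspec (L : ℕ) (k j : ℕ) (u1 : Site L) : PSpec L := fun v =>
  if v = stair L u1 j then endL j
  else if v = stair L u1 (j + k - 1) then endR k j
  else if v ∈ (Finset.Icc (j + 1) (j + k - 2)).image (stair L u1) then 3
  else 0

section Combinatorics

/-- The Pauli letter of a bond: `X` for `true`, `Y` for `false`. -/
def letter (c : Bool) : Fin 4 := if c then 1 else 2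

theorem letter_ne_zero (c : Bool) : letter c ≠ 0 := by
  cases c <;> decide

theorem eq_three_of_xor_letter :
    ∀ (x : Fin 4) (c d : Bool), x ≠ 0 → x ^^^ letter c = letter d → x = 3 ∧ d = !c := by
  decide

theorem xor_letter_eq_zero : ∀ (x : Fin 4) (c : Bool), x ^^^ letter c = 0 ↔ x = letter c := by
  decide

theorem Fin.four_xor_zero : ∀ x : Fin 4, x ^^^ 0 = x := by
  decide

theorem Fin.four_zero_xor : ∀ x : Fin 4, 0 ^^^ x = x := by
  decide

variable {G : Type*} [AddCommGroup G] [DecidableEq G]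

/-- The two-site product with letter `letter c` at `u` and `u + e c`. -/
def bondSpec (e : Bool → G) (c : Bool) (u : G) : G → Fin 4 :=
  fun v => if v = u ∨ v = u + e c then letter c else 0

/-- The product of two Pauli products, up to a phase. -/
def specMul {G : Type*} (σ τ : G → Fin 4) : G → Fin 4 := fun v => σ v ^^^ τ v

/-- The letter `y` is the identity or equal to `x`. -/
def LetterComm (x y : Fin 4) : Prop := y = 0 ∨ y = x

/-- The bond of letter `c` at `u` anticommutes with `σ`. -/
def BondAnti (e : Bool → G) (c : Bool) (u : G) (σ : G → Fin 4) : Prop :=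
  ¬ (LetterComm (letter c) (σ u) ↔ LetterComm (letter c) (σ (u + e c)))

theorem bondSpec_neg (e : Bool → G) (c : Bool) (u : G) :
    bondSpec (-e) c u = bondSpec e c (u - e c) := by
  funext v
  simp only [bondSpec, Pi.neg_apply, ← sub_eq_add_neg, sub_add_cancel]
  simp only [or_comm]

omit [DecidableEq G] in
theorem bondAnti_neg (e : Bool → G) (c : Bool) (u : G) (σ : G → Fin 4) :
    BondAnti (-e) c u σ ↔ BondAnti e c (u - e c) σ := by
  simp only [BondAnti, Pi.neg_apply, ← sub_eq_add_neg, sub_add_cancel]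
  tauto

/-- Coefficients `q` of an operator commuting with the bond Hamiltonian: no single bond can
produce an uncancelled product, and supports are never spread over more than `n + 1` levels. -/
structure Cancelling (L n : ℕ) (lev : G →+ ZMod L) (e : Bool → G)
    (q : (G → Fin 4) → ℂ) : Prop where
  pos : 1 ≤ n
  two_mul_le : 2 * (n + 1) ≤ L
  lev_e : ∀ c, lev (e c) = 1
  cancel : ∀ σ c u, q σ ≠ 0 → BondAnti e c u σ →
    ∃ d v, (d, v) ≠ (c, u) ∧ BondAnti e d v (specMul σ (bondSpec e c u)) ∧
      q (specMul (specMul σ (bondSpec e c u)) (bondSpec e d v)) ≠ 0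
  sep : ∀ σ, q σ ≠ 0 → ∀ u v, σ u ≠ 0 → σ v ≠ 0 → lev v ≠ lev u + (n + 1 : ℕ)

/-- `σ` has nonzero coefficient, and its support occupies the levels `a, …, a + n`, including
both extreme ones. -/
structure Spans (L n : ℕ) (lev : G →+ ZMod L) (q : (G → Fin 4) → ℂ)
    (σ : G → Fin 4) (a : ZMod L) : Prop where
  ne_zero : q σ ≠ 0
  window : ∀ u, σ u ≠ 0 → ∃ i : ℕ, i ≤ n ∧ lev u = a + i
  bottom : ∃ u, σ u ≠ 0 ∧ lev u = a
  top : ∃ u, σ u ≠ 0 ∧ lev u = a + n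

variable {L n : ℕ} {lev : G →+ ZMod L} {e : Bool → G} {q : (G → Fin 4) → ℂ}
  {σ : G → Fin 4} {a : ZMod L}

theorem Cancelling.neg (h : Cancelling L n lev e q) : Cancelling L n (-lev) (-e) q where
  pos := h.pos
  two_mul_le := h.two_mul_le
  lev_e c := by simp [h.lev_e]
  cancel σ c u hσ hb := by
    rw [bondAnti_neg] at hb
    obtain ⟨d, v, hne, hanti, hq⟩ := h.cancel σ c _ hσ hb
    refine ⟨d, v + e d, ?_, ?_, ?_⟩
    · rintro heq
      simp only [Prod.mk.injEq] at heq
      obtain ⟨rfl, rfl⟩ := heq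
      simp at hne
    · rw [bondAnti_neg, bondSpec_neg]
      simpa using hanti
    · rw [bondSpec_neg, bondSpec_neg]
      simpa using hq
  sep σ hσ u v hu hv heq := by
    refine h.sep σ hσ v u hv hu ?_
    simp only [AddMonoidHom.neg_apply] at heq
    linear_combination heq

omit [DecidableEq G] in
theorem Spans.neg (h : Spans L n lev q σ a) : Spans L n (-lev) q σ (-(a + n)) where
  ne_zero := h.ne_zero
  window u hu := by
    obtain ⟨i, hi, hl⟩ := h.window u hu
    refine ⟨n - i, by omega, ?_⟩
    simp only [AddMonoidHom.neg_apply, hl]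
    push_cast [hi]
    ring
  bottom := by
    obtain ⟨u, hu, hl⟩ := h.top
    exact ⟨u, hu, by simp [hl]⟩
  top := by
    obtain ⟨u, hu, hl⟩ := h.bottom
    exact ⟨u, hu, by simp [hl]⟩

theorem level_injective {i j : ℕ} (hi : i < L) (hj : j < L)
    (h : a + (i : ZMod L) = a + (j : ZMod L)) : i = j := by
  have := (ZMod.natCast_eq_natCast_iff' i j L).1 (add_left_cancel h)
  rwa [Nat.mod_eq_of_lt hi, Nat.mod_eq_of_lt hj] at this

theorem bondSpec_apply_of_ne {c : Bool} {u v : G} (h₁ : v ≠ u) (h₂ : v ≠ u + e c) :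
    bondSpec e c u v = 0 := by
  simp [bondSpec, h₁, h₂]

omit [DecidableEq G] in
theorem ne_of_level {u v : G} {i j : ℕ} (hu : lev u = a + i) (hv : lev v = a + j)
    (hi : i < L) (hj : j < L) (hij : i ≠ j) : u ≠ v := by
  rintro rfl
  exact hij (level_injective hi hj (hu.symm.trans hv))

omit [DecidableEq G] in
theorem Spans.apply_eq_zero (h : Spans L n lev q σ a) {v : G} {i : ℕ}
    (hv : lev v = a + i) (hi : i < L) (hni : n < i) : σ v = 0 := by
  by_contra hne
  obtain ⟨j, hj, hl⟩ := h.window v hne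
  have := level_injective hi (by omega) (hv.symm.trans hl)
  omega

theorem specMul_bondSpec_of_ne {c : Bool} {u v : G} (h₁ : v ≠ u) (h₂ : v ≠ u + e c) :
    specMul σ (bondSpec e c u) v = σ v := by
  simp only [specMul, bondSpec_apply_of_ne h₁ h₂, Fin.four_xor_zero]

theorem specMul_bondSpec_left (c : Bool) (u : G) :
    specMul σ (bondSpec e c u) u = σ u ^^^ letter c := by
  simp [specMul, bondSpec]

theorem specMul_bondSpec_right (c : Bool) (u : G) :
    specMul σ (bondSpec e c u) (u + e c) = σ (u + e c) ^^^ letter c := by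
  simp [specMul, bondSpec]

theorem specMul_bondSpec_eq_zero {c : Bool} {u v : G} (hv : σ v ≠ 0)
    (h : specMul σ (bondSpec e c u) v = 0) : σ v = letter c ∧ (v = u ∨ v = u + e c) := by
  by_cases hu : v = u ∨ v = u + e c
  · refine ⟨?_, hu⟩
    rw [← xor_letter_eq_zero]
    simpa [specMul, bondSpec, hu] using h
  · simp only [not_or] at hu
    rw [specMul_bondSpec_of_ne hu.1 hu.2] at h
    exact absurd h hv

/-- Appending a bond at the top of `σ` forces the bottom of `σ` to be a single site that can be
truncated by another bond. -/
theorem Cancelling.exists_bottom (h : Cancelling L n lev e q) (hσ : Spans L n lev q σ a)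
    {u : G} {c : Bool} (hu : σ u ≠ 0) (hlu : lev u = a + n) (hc : σ u ≠ letter c) :
    ∃ v d, σ v = letter d ∧ lev v = a ∧ (∀ w, σ w ≠ 0 → lev w = a → w = v) ∧
      specMul σ (bondSpec e c u) (v + e d) ≠ 0 ∧
      specMul σ (bondSpec e c u) (v + e d) ≠ letter d ∧
      q (specMul (specMul σ (bondSpec e c u)) (bondSpec e d v)) ≠ 0 := by
  have hn := h.pos
  have hL := h.two_mul_le
  have hlu' : lev (u + e c) = a + (n + 1 : ℕ) := by
    rw [map_add, hlu, h.lev_e]; push_cast; ring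
  have hu' : σ (u + e c) = 0 := hσ.apply_eq_zero hlu' (by omega) (by omega)
  obtain ⟨d, v, hne, hanti, hq⟩ := h.cancel σ c u hσ.ne_zero (by
    simp only [BondAnti, LetterComm, hu, hu', hc]; simp)
  set τ := specMul σ (bondSpec e c u) with hτ
  have hτtop : τ (u + e c) = letter c := by
    rw [hτ, specMul_bondSpec_right, hu', Fin.four_zero_xor]
  have hτbot : ∀ w, lev w = a → τ w = σ w := fun w hw => by
    have hw' : lev w = a + (0 : ℕ) := by simpa using hw
    exact specMul_bondSpec_of_ne (ne_of_level hw' hlu (by omega) (by omega) (by omega))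
      (ne_of_level hw' hlu' (by omega) (by omega) (by omega))
  have hτout : ∀ w i, lev w = a + (i : ℕ) → i < L → n + 1 < i → τ w = 0 := fun w i hw hi hni => by
    rw [hτ, specMul_bondSpec_of_ne (ne_of_level hw hlu hi (by omega) (by omega))
      (ne_of_level hw hlu' hi (by omega) (by omega))]
    exact hσ.apply_eq_zero hw hi (by omega)
  have htop : specMul τ (bondSpec e d v) (u + e c) ≠ 0 := by
    intro h0
    obtain ⟨hd, hv⟩ := specMul_bondSpec_eq_zero (hτtop ▸ letter_ne_zero c) h0
    have hcd : c = d := by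
      rw [hτtop] at hd
      revert hd; cases c <;> cases d <;> decide
    subst hcd
    rcases hv with hv | hv
    · have hv' : τ (v + e c) = 0 := by
        refine hτout _ (n + 2) ?_ (by omega) (by omega)
        rw [map_add, ← hv, hlu', h.lev_e]; push_cast; ring
      apply hanti
      rw [← hv, hτtop, hv, hv']
      simp [LetterComm]
    · exact hne (by rw [add_right_cancel hv])
  have hbot : ∀ w, σ w ≠ 0 → lev w = a → w = v ∧ σ v = letter d := by
    intro w hw hlw
    have h0 : specMul τ (bondSpec e d v) w = 0 := by
      by_contra h0
      exact h.sep _ hq w _ h0 htop (by rw [hlw, hlu'])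
    obtain ⟨hd, hv⟩ := specMul_bondSpec_eq_zero (by rwa [hτbot w hlw]) h0
    rcases hv with rfl | hv
    · exact ⟨rfl, by rwa [hτbot w hlw] at hd⟩
    · exfalso
      have hlv : lev v = a + (L - 1 : ℕ) := by
        rw [hv, map_add, h.lev_e] at hlw
        push_cast [show 1 ≤ L by omega]
        simp only [CharP.cast_eq_zero]
        linear_combination hlw
      have hv0 := hτout v (L - 1) hlv (by omega) (by omega)
      apply hanti
      rw [← hv, hd, hv0]
      simp [LetterComm]
  obtain ⟨w, hw, hlw⟩ := hσ.bottom
  obtain ⟨rfl, hd⟩ := hbot w hw hlw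
  have hd' : τ w = letter d := by rw [hτbot w hlw, hd]
  refine ⟨w, d, hd, hlw, fun w' hw' hl' => (hbot w' hw' hl').1, ?_, ?_, hq⟩
  · intro h0
    apply hanti
    rw [hd', h0]
    simp [LetterComm]
  · intro h0
    apply hanti
    rw [hd', h0]

theorem exists_letter_ne (x : Fin 4) : ∃ c, x ≠ letter c := by
  revert x; decide

theorem Cancelling.exists_top (h : Cancelling L n lev e q) (hσ : Spans L n lev q σ a)
    {v : G} {d : Bool} (hv : σ v ≠ 0) (hlv : lev v = a) (hd : σ v ≠ letter d) :
    ∃ u c, σ u = letter c ∧ lev u = a + n ∧ (∀ w, σ w ≠ 0 → lev w = a + n → w = u) ∧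
      specMul σ (bondSpec e d (v - e d)) (u - e c) ≠ 0 := by
  obtain ⟨u, c, huc, hlu, huniq, hne, -, -⟩ :=
    h.neg.exists_bottom hσ.neg hv (by simp [hlv]) hd
  refine ⟨u, c, huc, ?_, fun w hw hl => huniq w hw (by simp [hl]), ?_⟩
  · simpa [neg_eq_iff_eq_neg] using hlu
  · simpa [bondSpec_neg, ← sub_eq_add_neg] using hne

/-- A product spanning `n + 1` levels has a single top site, carrying `X` or `Y`, and the site
below it in the corresponding direction is occupied. -/
theorem Cancelling.top_site (h : Cancelling L n lev e q) (hσ : Spans L n lev q σ a) :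
    ∃ u c, σ u = letter c ∧ lev u = a + n ∧ (∀ w, σ w ≠ 0 → lev w = a + n → w = u) ∧
      σ (u - e c) ≠ 0 := by
  have hn := h.pos
  have hL := h.two_mul_le
  obtain ⟨v, hv, hlv⟩ := hσ.bottom
  obtain ⟨d, hd⟩ := exists_letter_ne (σ v)
  obtain ⟨u, c, huc, hlu, huniq, hne⟩ := h.exists_top hσ hv hlv hd
  refine ⟨u, c, huc, hlu, huniq, fun h0 => ?_⟩
  by_cases huv : u - e c = v
  · exact hv (huv ▸ h0)
  · rw [specMul_bondSpec_of_ne _ (by simpa using huv), h0] at hne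
    · exact hne rfl
    · have h1 : lev (u - e c) = (a - 1) + (n : ℕ) := by
        rw [map_sub, hlu, h.lev_e]; ring
      have h2 : lev (v - e d) = (a - 1) + (0 : ℕ) := by
        rw [map_sub, hlv, h.lev_e]; simp
      exact ne_of_level h1 h2 (by omega) (by omega) (by omega)

/-- The staircase starting at `v` in direction `d` and alternating directions. -/
def climb (e : Bool → G) : G → Bool → ℕ → G
  | v, _, 0 => v
  | v, d, i + 1 => climb e (v + e d) (!d) i

omit [DecidableEq G] in
theorem lev_climb (he : ∀ c, lev (e c) = 1) (v : G) (d : Bool) (i : ℕ) :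
    lev (climb e v d i) = lev v + i := by
  induction i generalizing v d with
  | zero => simp [climb]
  | succ i ih => rw [climb, ih, map_add, he]; push_cast; ring

omit [DecidableEq G] in
theorem climb_succ (v : G) (d : Bool) (i : ℕ) :
    climb e v d (i + 1) = climb e v d i + e (d ^^ (i % 2 == 1)) := by
  induction i generalizing v d with
  | zero => simp [climb]
  | succ i ih =>
    rw [climb, ih, climb]
    congr 2
    rcases Nat.mod_two_eq_zero_or_one i with hi | hi
    · simp [Nat.add_mod, hi]
    · simp [Nat.add_mod, hi]

/-- The lowest `m` levels of a product spanning `n + 1` levels form a staircase of `Z`s. -/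
theorem Cancelling.staircase (h : Cancelling L n lev e q) (m : ℕ) (hm : m ≤ n) :
    ∀ (σ : G → Fin 4) (a : ZMod L), Spans L n lev q σ a →
    ∃ v d, σ v = letter d ∧ lev v = a ∧ ∀ i, i ≤ m →
      (∀ w, lev w = a + (i : ℕ) → (σ w ≠ 0 ↔ w = climb e v d i)) ∧
      (1 ≤ i → i < n → σ (climb e v d i) = 3) := by
  have hn := h.pos
  have hL := h.two_mul_le
  induction m with
  | zero =>
    intro σ a hσ
    obtain ⟨u, hu, hlu⟩ := hσ.top
    obtain ⟨c, hc⟩ := exists_letter_ne (σ u)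
    obtain ⟨v, d, hvd, hlv, huniq, -⟩ := h.exists_bottom hσ hu hlu hc
    refine ⟨v, d, hvd, hlv, fun i hi => ?_⟩
    obtain rfl : i = 0 := by omega
    refine ⟨fun w hw => ⟨fun h0 => huniq w h0 (by simpa using hw), ?_⟩, fun h1 => by omega⟩
    intro hwv
    change w = v at hwv
    rw [hwv, hvd]
    exact letter_ne_zero d
  | succ m ih =>
    intro σ a hσ
    obtain ⟨u, c', huc, hlu, htop, -⟩ := h.top_site hσ
    have hu : σ u ≠ 0 := huc ▸ letter_ne_zero c'
    obtain ⟨c, hc⟩ := exists_letter_ne (σ u)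
    obtain ⟨v, d, hvd, hlv, huniq, hne0, hned, hq⟩ := h.exists_bottom hσ hu hlu hc
    set τ := specMul σ (bondSpec e c u) with hτ
    set ρ := specMul τ (bondSpec e d v) with hρ
    have hlu' : lev (u + e c) = a + (n + 1 : ℕ) := by
      rw [map_add, hlu, h.lev_e]; push_cast; ring
    have hlv0 : lev v = a + (0 : ℕ) := by simpa using hlv
    have hlv' : lev (v + e d) = a + (1 : ℕ) := by
      rw [map_add, hlv, h.lev_e]; simp
    have hρv' : ρ (v + e d) = τ (v + e d) ^^^ letter d := specMul_bondSpec_right d v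
    have hρ1 : ρ (v + e d) ≠ 0 := by
      rw [hρv', Ne, xor_letter_eq_zero]
      exact hned
    have hτu : τ u ≠ 0 := by
      rw [hτ, specMul_bondSpec_left, Ne, xor_letter_eq_zero]
      exact hc
    have hτσ : ∀ w i, lev w = a + (i : ℕ) → i ≤ n → (τ w ≠ 0 ↔ σ w ≠ 0) := by
      intro w i hw hi
      by_cases hwu : w = u
      · subst hwu
        exact iff_of_true hτu hu
      · rw [hτ, specMul_bondSpec_of_ne hwu
          (ne_of_level hw hlu' (by omega) (by omega) (by omega))]
    have hρτ : ∀ w, w ≠ v → (ρ w ≠ 0 ↔ τ w ≠ 0) := by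
      intro w hw
      by_cases hwv : w = v + e d
      · subst hwv
        exact iff_of_true hρ1 hne0
      · rw [hρ, specMul_bondSpec_of_ne hw hwv]
    have hρv : ρ v = 0 := by
      rw [hρ, specMul_bondSpec_left, xor_letter_eq_zero, hτ, specMul_bondSpec_of_ne, hvd]
      · exact ne_of_level hlv0 hlu (by omega) (by omega) (by omega)
      · exact ne_of_level hlv0 hlu' (by omega) (by omega) (by omega)
    have hlev : ∀ w (i : ℕ), lev w = a + 1 + (i : ℕ) ↔ lev w = a + (i + 1 : ℕ) := by
      intro w i
      push_cast
      rw [add_assoc, add_comm (1 : ZMod L)]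
    have hspan : Spans L n lev q ρ (a + 1) := by
      refine ⟨hq, fun w hw => ?_, ⟨v + e d, hρ1, by simpa using hlv'⟩, ⟨u + e c, ?_, ?_⟩⟩
      · have hwv : w ≠ v := by rintro rfl; exact hw hρv
        have hτw := (hρτ w hwv).1 hw
        by_cases hwu : w = u + e c
        · exact ⟨n, le_rfl, by rw [hlev, hwu, hlu']⟩
        · have hσw : σ w ≠ 0 := by
            by_cases hwu' : w = u
            · rwa [hwu']
            · rwa [hτ, specMul_bondSpec_of_ne hwu' hwu] at hτw
          obtain ⟨i, hi, hl⟩ := hσ.window w hσw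
          rcases i with _ | i
          · exact absurd (huniq w hσw (by simpa using hl)) hwv
          · exact ⟨i, by omega, by rw [hlev, hl]⟩
      · rw [hρτ _ (ne_of_level hlu' hlv0 (by omega) (by omega) (by omega)), hτ,
          specMul_bondSpec_right, hσ.apply_eq_zero hlu' (by omega) (by omega), Fin.four_zero_xor]
        exact letter_ne_zero c
      · rw [hlev, hlu']
    obtain ⟨v', d', hv'd', hlv'', hstair⟩ := ih (by omega) ρ (a + 1) hspan
    have hv' : v + e d = v' :=
      ((hstair 0 (by omega)).1 _ (by simpa using hlv')).1 hρ1
    subst hv'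
    rw [hρv'] at hv'd'
    obtain ⟨hτ3, rfl⟩ := eq_three_of_xor_letter _ _ _ hne0 hv'd'
    refine ⟨v, d, hvd, hlv, fun i hi => ?_⟩
    rcases i with _ | i
    · refine ⟨fun w hw => ⟨fun h0 => huniq w h0 (by simpa using hw), ?_⟩, fun h1 => by omega⟩
      intro hwv
      change w = v at hwv
      rw [hwv, hvd]
      exact letter_ne_zero d
    · obtain ⟨hsupp, hthree⟩ := hstair i (by omega)
      refine ⟨fun w hw => ?_, fun _ hin => ?_⟩
      · rw [← hτσ w (i + 1) hw (by omega),
          ← hρτ w (ne_of_level hw hlv0 (by omega) (by omega) (by omega))]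
        exact hsupp w ((hlev w i).2 hw)
      · have hl : lev (climb e v d (i + 1)) = a + (i + 1 : ℕ) := by
          rw [lev_climb h.lev_e, hlv]
        have hτeq : τ (climb e v d (i + 1)) = σ (climb e v d (i + 1)) :=
          specMul_bondSpec_of_ne (ne_of_level hl hlu (by omega) (by omega) (by omega))
            (ne_of_level hl hlu' (by omega) (by omega) (by omega))
        rw [← hτeq]
        rcases i with _ | i
        · exact hτ3
        · have hρeq : ρ (climb e v d (i + 1 + 1)) = τ (climb e v d (i + 1 + 1)) :=
            specMul_bondSpec_of_ne (ne_of_level hl hlv0 (by omega) (by omega) (by omega))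
              (ne_of_level hl hlv' (by omega) (by omega) (by omega))
          rw [← hρeq]
          exact hthree (by omega) (by omega)

/-- A product spanning `n + 1` levels is a staircase of `Z`s with end letters `X` or `Y`. -/
theorem Cancelling.eq_staircase (h : Cancelling L n lev e q) (he : Function.Injective e)
    (hσ : Spans L n lev q σ a) :
    ∃ v d, σ v = letter d ∧ (∀ w, σ w ≠ 0 ↔ ∃ i ≤ n, w = climb e v d i) ∧
      (∀ i, 1 ≤ i → i < n → σ (climb e v d i) = 3) ∧
      σ (climb e v d n) = letter (d ^^ ((n - 1) % 2 == 1)) := by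
  have hn := h.pos
  have hL := h.two_mul_le
  obtain ⟨v, d, hvd, hlv, hstair⟩ := h.staircase n le_rfl σ a hσ
  have hlev : ∀ i, lev (climb e v d i) = a + (i : ℕ) := fun i => by
    rw [lev_climb h.lev_e, hlv]
  refine ⟨v, d, hvd, fun w => ⟨fun hw => ?_, ?_⟩, fun i h1 hi => (hstair i hi.le).2 h1 hi, ?_⟩
  · obtain ⟨i, hi, hl⟩ := hσ.window w hw
    exact ⟨i, hi, ((hstair i hi).1 w hl).1 hw⟩
  · rintro ⟨i, hi, rfl⟩
    exact ((hstair i hi).1 _ (hlev i)).2 rfl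
  · obtain ⟨u, c, huc, hlu, -, hne⟩ := h.top_site hσ
    have hu : u = climb e v d n :=
      ((hstair n le_rfl).1 u hlu).1 (huc ▸ letter_ne_zero c)
    obtain ⟨p, rfl⟩ : ∃ p, n = p + 1 := ⟨n - 1, by omega⟩
    have hp : u - e c = climb e v d p := by
      refine ((hstair p (by omega)).1 _ ?_).1 hne
      rw [map_sub, hlu, h.lev_e]; push_cast; ring
    have hcd : c = (d ^^ (p % 2 == 1)) := by
      apply he
      rw [climb_succ, ← hp] at hu
      have := congrArg (· - (u - e c)) hu
      simpa using this
    rw [← hu, huc, hcd, Nat.add_sub_cancel]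

end Combinatorics

section Operators

/-- The phase in the product of two Pauli matrices. -/
noncomputable def sitePhase (a b : Fin 4) : ℂ :=
  if a = 0 ∨ b = 0 ∨ a = b then 1
  else if (a = 1 ∧ b = 2) ∨ (a = 2 ∧ b = 3) ∨ (a = 3 ∧ b = 1) then Complex.I
  else -Complex.I

theorem pauli_mul (a b : Fin 4) : pauli a * pauli b = sitePhase a b • pauli (a ^^^ b) := by
  fin_cases a <;> fin_cases b <;> ext i j <;> fin_cases i <;> fin_cases j <;>
    simp [pauli, sitePhase, Matrix.mul_apply, Fin.sum_univ_two]

theorem sitePhase_ne_zero (a b : Fin 4) : sitePhase a b ≠ 0 := by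
  unfold sitePhase; split_ifs <;> simp

theorem trace_pauli (a : Fin 4) : (pauli a).trace = if a = 0 then 2 else 0 := by
  fin_cases a <;> simp [pauli, Matrix.trace, Fin.sum_univ_two]

open Classical in
/-- The sign relating the two orders of a product of Pauli matrices. -/
noncomputable def siteSign (x y : Fin 4) : ℂ := if x = 0 ∨ LetterComm x y then 1 else -1

theorem sitePhase_swap (a b : Fin 4) : sitePhase a b = siteSign a b * sitePhase b a := by
  fin_cases a <;> fin_cases b <;> simp [sitePhase, siteSign, LetterComm]

variable {L : ℕ} [NeZero L]

/-- The phase in the product of two Pauli products. -/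
noncomputable def specPhase (σ τ : PSpec L) : ℂ := ∏ u, sitePhase (σ u) (τ u)

theorem specPhase_ne_zero (σ τ : PSpec L) : specPhase σ τ ≠ 0 :=
  Finset.prod_ne_zero_iff.2 fun _ _ => sitePhase_ne_zero _ _

theorem PauliOp_mul (σ τ : PSpec L) :
    PauliOp L σ * PauliOp L τ = specPhase σ τ • PauliOp L (specMul σ τ) := by
  ext s t
  simp only [Matrix.mul_apply, PauliOp, Matrix.smul_apply, smul_eq_mul, specPhase,
    ← Finset.prod_mul_distrib, specMul]
  rw [← Fintype.prod_sum fun u r => pauli (σ u) (s u) r * pauli (τ u) r (t u)]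
  refine Finset.prod_congr rfl fun u _ => ?_
  have := congrFun (congrFun (pauli_mul (σ u) (τ u)) (s u)) (t u)
  simpa [Matrix.mul_apply] using this

theorem trace_PauliOp (σ : PSpec L) :
    (PauliOp L σ).trace = if σ = 0 then 2 ^ Fintype.card (Site L) else 0 := by
  have h : (PauliOp L σ).trace = ∏ u, (pauli (σ u)).trace := by
    simp only [Matrix.trace, PauliOp, Matrix.diag_apply]
    rw [← Fintype.prod_sum fun u r => pauli (σ u) r r]
  rw [h]
  split_ifs with h0
  · subst h0
    simp [trace_pauli]
  · obtain ⟨u, hu⟩ := Function.ne_iff.1 h0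
    exact Finset.prod_eq_zero (Finset.mem_univ u) (by rw [trace_pauli]; simpa using hu)

theorem xor_eq_zero_iff_four : ∀ x y : Fin 4, x ^^^ y = 0 ↔ x = y := by
  decide

omit [NeZero L] in
theorem specMul_eq_zero {σ τ : PSpec L} : specMul σ τ = 0 ↔ σ = τ := by
  simp only [funext_iff, specMul, Pi.zero_apply, xor_eq_zero_iff_four]

theorem specMul_specMul_self {G : Type*} (σ τ : G → Fin 4) :
    specMul τ (specMul σ τ) = σ := by
  have : ∀ x y : Fin 4, y ^^^ (x ^^^ y) = x := by decide
  funext u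
  exact this _ _

theorem specMul_comm {G : Type*} (σ τ : G → Fin 4) : specMul σ τ = specMul τ σ := by
  have : ∀ x y : Fin 4, x ^^^ y = y ^^^ x := by decide
  funext u
  exact this _ _

theorem trace_mul_opComm (β ρ σ : PSpec L) :
    (PauliOp L ρ * opComm L (PauliOp L β) (PauliOp L σ)).trace =
      if σ = specMul ρ β then
        specPhase ρ ρ * 2 ^ Fintype.card (Site L) * (specPhase β σ - specPhase σ β) else 0 := by
  rw [opComm, PauliOp_mul, PauliOp_mul, specMul_comm σ β, ← sub_smul, mul_smul_comm,
    Matrix.trace_smul, PauliOp_mul, Matrix.trace_smul, trace_PauliOp]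
  have hiff : specMul ρ (specMul β σ) = 0 ↔ σ = specMul ρ β := by
    rw [specMul_eq_zero]
    constructor
    · rintro rfl
      rw [specMul_comm (specMul β σ), specMul_comm β σ, specMul_specMul_self]
    · rintro rfl
      rw [specMul_specMul_self]
  by_cases hσ : σ = specMul ρ β
  · rw [if_pos (hiff.2 hσ), if_pos hσ, hσ, specMul_specMul_self]
    simp only [smul_eq_mul]
    ring
  · rw [if_neg (fun hc => hσ (hiff.1 hc)), if_neg hσ]
    simp

/-- The bond directions of the square lattice. -/
def bondDir (L : ℕ) (c : Bool) : Site L := if c then (1, 0) else (0, 1)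

theorem specPhase_bond (hL : 4 ≤ L) (c : Bool) (u : Site L) (σ : PSpec L) :
    specPhase (bondSpec (bondDir L) c u) σ =
      siteSign (letter c) (σ u) * siteSign (letter c) (σ (u + bondDir L c)) *
        specPhase σ (bondSpec (bondDir L) c u) := by
  have : Fact (1 < L) := ⟨by omega⟩
  have hne : u ≠ u + bondDir L c := by
    cases c <;> simp [bondDir, Prod.ext_iff]
  have hsign : ∏ v, siteSign (bondSpec (bondDir L) c u v) (σ v) =
      siteSign (letter c) (σ u) * siteSign (letter c) (σ (u + bondDir L c)) := by
    rw [← Finset.prod_subset (Finset.subset_univ {u, u + bondDir L c}), Finset.prod_pair hne]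
    · simp [bondSpec]
    · intro v _ hv
      simp only [Finset.mem_insert, Finset.mem_singleton, not_or] at hv
      rw [bondSpec_apply_of_ne hv.1 hv.2]
      simp [siteSign]
  rw [← hsign, specPhase, specPhase, ← Finset.prod_mul_distrib]
  exact Finset.prod_congr rfl fun v _ => sitePhase_swap _ _

theorem specPhase_bond_sub (hL : 4 ≤ L) (c : Bool) (u : Site L) (σ : PSpec L) :
    specPhase (bondSpec (bondDir L) c u) σ - specPhase σ (bondSpec (bondDir L) c u) ≠ 0 ↔
      BondAnti (bondDir L) c u σ := by
  have h0 := specPhase_ne_zero σ (bondSpec (bondDir L) c u)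
  rw [specPhase_bond hL]
  simp only [siteSign, BondAnti]
  by_cases h1 : LetterComm (letter c) (σ u) <;>
    by_cases h2 : LetterComm (letter c) (σ (u + bondDir L c)) <;>
    simp [h1, h2, h0, letter_ne_zero, sub_eq_zero, neg_eq_self]

theorem letterComm_xor (c : Bool) (x : Fin 4) :
    LetterComm (letter c) (x ^^^ letter c) ↔ LetterComm (letter c) x := by
  unfold LetterComm
  revert c x; decide

omit [NeZero L] in
theorem bondAnti_specMul (c : Bool) (u : Site L) (σ : PSpec L) :
    BondAnti (bondDir L) c u (specMul σ (bondSpec (bondDir L) c u)) ↔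
      BondAnti (bondDir L) c u σ := by
  simp only [BondAnti, specMul_bondSpec_left, specMul_bondSpec_right, letterComm_xor]

theorem Hcompass_eq (Jx Jy : ℝ) :
    Hcompass L Jx Jy = - ∑ b : Bool × Site L,
      ((if b.1 then Jx else Jy : ℝ) : ℂ) • PauliOp L (bondSpec (bondDir L) b.1 b.2) := by
  rw [Hcompass, Fintype.sum_prod_type (α₁ := Bool), Fintype.sum_bool, ← Finset.sum_add_distrib]
  have hX : ∀ u, sigXX L u = bondSpec (bondDir L) true u := fun u => by
    funext v; simp only [sigXX, bondSpec, bondDir, letter]; split_ifs <;> simp_all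
  have hY : ∀ u, sigYY L u = bondSpec (bondDir L) false u := fun u => by
    funext v; simp only [sigYY, bondSpec, bondDir, letter]; split_ifs <;> simp_all
  simp [hX, hY]

/-- Extracting the coefficient of the product `ρ` in `[H, Q] = 0`. -/
theorem sum_bonds_eq_zero {Jx Jy : ℝ} {q : PSpec L → ℂ}
    (hcons : opComm L (Hcompass L Jx Jy) (Qop L q) = 0) (ρ : PSpec L) :
    ∑ b : Bool × Site L, ((if b.1 then Jx else Jy : ℝ) : ℂ) *
      (q (specMul ρ (bondSpec (bondDir L) b.1 b.2)) *
        (specPhase (bondSpec (bondDir L) b.1 b.2) (specMul ρ (bondSpec (bondDir L) b.1 b.2)) -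
          specPhase (specMul ρ (bondSpec (bondDir L) b.1 b.2))
            (bondSpec (bondDir L) b.1 b.2))) = 0 := by
  have hexp : opComm L (Hcompass L Jx Jy) (Qop L q) = - ∑ b : Bool × Site L, ∑ σ : PSpec L,
      (((if b.1 then Jx else Jy : ℝ) : ℂ) * q σ) •
        opComm L (PauliOp L (bondSpec (bondDir L) b.1 b.2)) (PauliOp L σ) := by
    rw [Hcompass_eq, Qop]
    simp only [opComm, neg_mul, mul_neg, smul_sub, Finset.sum_sub_distrib]
    rw [Finset.sum_mul_sum, Finset.sum_mul_sum,
      Finset.sum_comm (s := (Finset.univ : Finset (PSpec L)))]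
    simp only [smul_mul_smul_comm, mul_comm (q _)]
    abel
  have htr := congrArg (fun M => (PauliOp L ρ * M).trace) (hexp.symm.trans hcons)
  simp only [mul_neg, mul_zero, Matrix.trace_zero, Matrix.trace_neg, neg_eq_zero,
    Finset.mul_sum, Matrix.trace_sum, mul_smul_comm, Matrix.trace_smul, trace_mul_opComm,
    smul_eq_mul, mul_ite, Finset.sum_ite_eq', Finset.mem_univ, if_true] at htr
  have hK : specPhase ρ ρ * (2 : ℂ) ^ Fintype.card (Site L) ≠ 0 :=
    mul_ne_zero (specPhase_ne_zero _ _) (by simp)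
  refine (mul_eq_zero.1 ?_).resolve_left hK
  rw [Finset.mul_sum, ← htr]
  exact Finset.sum_congr rfl fun b _ => by ring

theorem exists_cancelling_bond (hL : 4 ≤ L) {Jx Jy : ℝ} (hJx : Jx ≠ 0) (hJy : Jy ≠ 0)
    {q : PSpec L → ℂ} (hcons : opComm L (Hcompass L Jx Jy) (Qop L q) = 0)
    (σ : PSpec L) (c : Bool) (u : Site L) (hq : q σ ≠ 0) (hanti : BondAnti (bondDir L) c u σ) :
    ∃ d v, (d, v) ≠ (c, u) ∧
      BondAnti (bondDir L) d v (specMul σ (bondSpec (bondDir L) c u)) ∧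
      q (specMul (specMul σ (bondSpec (bondDir L) c u)) (bondSpec (bondDir L) d v)) ≠ 0 := by
  have hsum := sum_bonds_eq_zero hcons (specMul σ (bondSpec (bondDir L) c u))
  have hself : specMul (specMul σ (bondSpec (bondDir L) c u)) (bondSpec (bondDir L) c u) = σ := by
    rw [specMul_comm, specMul_specMul_self]
  have hterm := mul_ne_zero (a := (((if c then Jx else Jy : ℝ)) : ℂ))
    (by cases c <;> simpa) (mul_ne_zero hq ((specPhase_bond_sub hL c u σ).2 hanti))
  rw [← Finset.add_sum_erase _ _ (Finset.mem_univ (c, u))] at hsum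
  simp only [hself] at hsum
  obtain ⟨⟨d, v⟩, hmem, hne⟩ := Finset.exists_ne_zero_of_sum_ne_zero
    (fun h0 => hterm (by rwa [h0, add_zero] at hsum))
  refine ⟨d, v, (Finset.mem_erase.1 hmem).1, ?_, ?_⟩
  · rw [← bondAnti_specMul, ← specPhase_bond_sub hL]
    exact right_ne_zero_of_mul (right_ne_zero_of_mul hne)
  · exact left_ne_zero_of_mul (right_ne_zero_of_mul hne)

end Operators

section Diagonal

/-- The diagonal level of a site. -/
def levelHom (L : ℕ) : Site L →+ ZMod L where
  toFun u := u.1 + u.2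
  map_zero' := by simp
  map_add' u v := by simp only [Prod.fst_add, Prod.snd_add]; ring

variable {L : ℕ} [NeZero L]

theorem exists_diagBoundAt (σ : PSpec L) : ∃ a, DiagBoundAt L σ a (Diag L σ) :=
  Nat.sInf_mem (s := {k | ∃ a : ZMod L, DiagBoundAt L σ a k}) ⟨L, 0, fun _ _ => ZMod.val_lt _⟩

omit [NeZero L] in
theorem diag_le {σ : PSpec L} {a : ZMod L} {k : ℕ} (h : DiagBoundAt L σ a k) : Diag L σ ≤ k :=
  Nat.sInf_le ⟨a, h⟩

theorem levelHom_ne_add {σ : PSpec L} {k : ℕ} (hkL : 2 * k ≤ L) (hσ : Diag L σ ≤ k)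
    {u v : Site L} (hu : σ u ≠ 0) (hv : σ v ≠ 0) : levelHom L v ≠ levelHom L u + (k : ℕ) := by
  intro heq
  obtain ⟨a, ha⟩ := exists_diagBoundAt σ
  have h1 := ha u hu
  have h2 := ha v hv
  have h3 : (((v.1 + v.2 - a).val : ℕ) : ZMod L) = (((u.1 + u.2 - a).val + k : ℕ) : ZMod L) := by
    push_cast
    rw [ZMod.natCast_zmod_val, ZMod.natCast_zmod_val]
    change v.1 + v.2 = u.1 + u.2 + (k : ZMod L) at heq
    rw [heq]; ring
  rw [ZMod.natCast_eq_natCast_iff', Nat.mod_eq_of_lt (by omega), Nat.mod_eq_of_lt (by omega)] at h3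
  omega

theorem spans_of_diag {q : PSpec L → ℂ} {σ : PSpec L} {n : ℕ} (hn : 1 ≤ n)
    (hq : q σ ≠ 0) (hσ : Diag L σ = n + 1) : ∃ a, Spans L n (levelHom L) q σ a := by
  obtain ⟨a, ha⟩ := exists_diagBoundAt σ
  rw [hσ] at ha
  have hlev : ∀ u : Site L, levelHom L u = a + ((u.1 + u.2 - a).val : ℕ) := fun u => by
    rw [ZMod.natCast_zmod_val]
    change u.1 + u.2 = _
    ring
  refine ⟨a, hq, fun u hu => ⟨_, Nat.le_of_lt_succ (ha u hu), hlev u⟩, ?_, ?_⟩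
  · by_contra! hbot
    have hb : DiagBoundAt L σ (a + 1) n := by
      intro u hu
      have hlt := ha u hu
      have hval : (u.1 + u.2 - a).val ≠ 0 := fun h0 =>
        hbot u hu (by rw [hlev, h0]; simp)
      have hL := ZMod.val_lt (u.1 + u.2 - a)
      have : u.1 + u.2 - (a + 1) = (((u.1 + u.2 - a).val - 1 : ℕ) : ZMod L) := by
        rw [Nat.cast_sub (by omega), ZMod.natCast_zmod_val]
        push_cast; ring
      rw [this, ZMod.val_natCast, Nat.mod_eq_of_lt (by omega)]
      omega
    have := diag_le hb
    omega
  · by_contra! htop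
    have hb : DiagBoundAt L σ a n := by
      intro u hu
      have hlt := ha u hu
      have hval : (u.1 + u.2 - a).val ≠ n := fun h0 => htop u hu (by rw [hlev, h0])
      omega
    have := diag_le hb
    omega

omit [NeZero L] in
theorem stair_succ (u : Site L) (j : ℕ) (hj : 1 ≤ j) :
    stair L u (j + 1) = stair L u j + bondDir L (j % 2 == 1) := by
  rcases Nat.even_or_odd' j with ⟨m, rfl | rfl⟩
  · have h4 : 2 * m / 2 = m := by omega
    simp [stair, bondDir, h4]
  · have h1 : (2 * m + 1) % 2 = 1 := by omega
    have h2 : (2 * m + 1 + 1) % 2 = 0 := by omega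
    have h3 : (2 * m + 1 - 1) / 2 = m := by omega
    have h4 : (2 * m + 1 + 1) / 2 = m + 1 := by omega
    simp only [stair, bondDir, h1, h2, h3, h4]
    ext <;> simp <;> ring

omit [NeZero L] in
theorem climb_stair (u : Site L) (j : ℕ) (hj : 1 ≤ j) (i : ℕ) :
    climb (bondDir L) (stair L u j) (j % 2 == 1) i = stair L u (j + i) := by
  induction i generalizing j with
  | zero => rfl
  | succ i ih =>
    have hpar : (!(j % 2 == 1)) = ((j + 1) % 2 == 1) := by
      rcases Nat.mod_two_eq_zero_or_one j with h | h <;> simp [Nat.add_mod, h]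
    rw [climb, ← stair_succ u j hj, hpar, ih (j + 1) (by omega), Nat.add_right_comm, add_assoc]

omit [NeZero L] in
theorem eq_Cspec {σ : PSpec L} {n : ℕ} (hn : 1 ≤ n) (u : Site L) (j : ℕ)
    (hbot : σ (stair L u j) = letter (j % 2 == 1))
    (hsupp : ∀ w, σ w ≠ 0 ↔ ∃ i ≤ n, w = stair L u (j + i))
    (hmid : ∀ i, 1 ≤ i → i < n → σ (stair L u (j + i)) = 3)
    (htop : σ (stair L u (j + n)) = letter ((j % 2 == 1) ^^ ((n - 1) % 2 == 1))) :
    σ = Cspec L (n + 1) j u := by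
  funext w
  rw [Cspec]
  have e1 : j + (n + 1) - 1 = j + n := by omega
  rw [e1]
  split_ifs with h1 h2 h3
  · rw [h1, hbot, endL, letter]; simp
  · rw [h2, htop, endR, letter]
    obtain ⟨p, rfl⟩ : ∃ p, n = p + 1 := ⟨n - 1, by omega⟩
    rcases Nat.mod_two_eq_zero_or_one j with h | h <;>
      rcases Nat.mod_two_eq_zero_or_one p with h' | h' <;>
      simp [Nat.add_mod, h, h']
  · obtain ⟨i, hi, rfl⟩ := Finset.mem_image.1 h3
    rw [Finset.mem_Icc] at hi
    obtain ⟨p, rfl⟩ : ∃ p, i = j + p := ⟨i - j, by omega⟩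
    exact hmid p (by omega) (by omega)
  · by_contra hw
    obtain ⟨i, hi, rfl⟩ := (hsupp w).1 hw
    refine h3 (Finset.mem_image.2 ⟨j + i, Finset.mem_Icc.2 ⟨?_, ?_⟩, rfl⟩)
    · have : i ≠ 0 := by rintro rfl; exact h1 rfl
      omega
    · have : i ≠ n := by rintro rfl; exact h2 rfl
      omega

end Diagonal

/-- **Lemma 4 of the paper.** Let `2 ≤ k̄ ≤ L/2` and let `Q` be a
local conserved quantity. For a Pauli product `σ` with `Diag σ = k̄`, one has
`q_σ = 0` unless `σ` is a standard-form product `C^k̄_1` or `C^k̄_2` based at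
some site. -/
theorem coefficient_vanishes_unless_standard_form
    (L : ℕ) [NeZero L] (Jx Jy : ℝ) (hJx : Jx ≠ 0) (hJy : Jy ≠ 0)
    (k : ℕ) (hk : 2 ≤ k) (hkL : 2 * k ≤ L)
    (q : PSpec L → ℂ)
    (hsupp : ∀ σ : PSpec L, q σ ≠ 0 → σ ≠ 0 ∧ Diag L σ ≤ k)
    (hcons : opComm L (Hcompass L Jx Jy) (Qop L q) = 0)
    (σ : PSpec L) (hdiag : Diag L σ = k) (hq : q σ ≠ 0) :
    ∃ u1 : Site L, σ = Cspec L k 1 u1 ∨ σ = Cspec L k 2 u1 := by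
  obtain ⟨n, rfl⟩ : ∃ n, k = n + 1 := ⟨k - 1, by omega⟩
  have : Fact (1 < L) := ⟨by omega⟩
  have hcanc : Cancelling L n (levelHom L) (bondDir L) q :=
    { pos := by omega
      two_mul_le := hkL
      lev_e := fun c => by cases c <;> simp [levelHom, bondDir]
      cancel := exists_cancelling_bond (by omega) hJx hJy hcons
      sep := fun σ hσ u v hu hv => levelHom_ne_add hkL (hsupp σ hσ).2 hu hv }
  have hinj : Function.Injective (bondDir L) := by
    intro c d
    cases c <;> cases d <;> simp [bondDir]
  obtain ⟨a, ha⟩ := spans_of_diag (by omega) hq hdiag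
  obtain ⟨v, d, hvd, hsup, hmid, htop⟩ := hcanc.eq_staircase hinj ha
  cases d
  · have hv : stair L (v - (1, 0)) 2 = v := by
      simp [stair, Prod.ext_iff]
    have hc : ∀ i, climb (bondDir L) v false i = stair L (v - (1, 0)) (2 + i) := fun i => by
      rw [← climb_stair _ 2 (by omega), hv]
      rfl
    simp only [hc] at hsup hmid htop
    refine ⟨v - (1, 0), Or.inr (eq_Cspec (by omega) _ 2 ?_ hsup hmid htop)⟩
    rw [hv]; exact hvd
  · have hv : stair L v 1 = v := by
      simp [stair, Prod.ext_iff]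
    have hc : ∀ i, climb (bondDir L) v true i = stair L v (1 + i) := fun i => by
      rw [← climb_stair _ 1 (by omega), hv]
      rfl
    simp only [hc] at hsup hmid htop
    refine ⟨v, Or.inl (eq_Cspec (by omega) _ 1 ?_ hsup hmid htop)⟩
    rw [hv]; exact hvd
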